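/- arXiv:2506.16954 — 2 statements merged into one kernel-verified Lean document; each statement's English description precedes it below -/
import Mathlib

section
/- Fix integers m ≥ 3, 1 ≤ t ≤ m−1 and a real number c > 0. Let γ be a 3-Frenet helix in the de Sitter space form S^m_t(c) with constant curvatures κ, τ > 0 and signs (ε₁,ε₂,ε₃) ∈ {−1,1}³ (γ is automatically non-geodesic since ∇T = ε₂κN ≠ 0). Then: (i) γ is proper biharmonic (τ₂(γ) ≡ 0) if and only if ε₂(ε₁κ² + ε₃τ²) = cε₁; (ii) γ is proper triharmonic (τ₃(γ) ≡ 0) if and only if ε₂(ε₁κ² + ε₃τ²)² = c(ε₁ε₃τ² + 2κ²); (iii) for every integer r ≥ 4, γ is proper r-harmonic (τ_r(γ) ≡ 0) if and only if (ε₁κ² + ε₃τ²)^{r−3}·[ε₂(ε₁κ² + ε₃τ²)² − c(ε₁ε₃τ² + (r−1)κ²)] = 0. -/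
open scoped BigOperators

noncomputable section

/-- The pseudo-Euclidean bilinear form of index `t` on `ℝⁿ` (modelled as `Fin n → ℝ`):
`⟪x,y⟫_t = −∑_{i<t} x_i y_i + ∑_{i≥t} x_i y_i`. -/
def pform (t : ℕ) {n : ℕ} (x y : Fin n → ℝ) : ℝ :=
  ∑ i : Fin n, (if i.val < t then -(x i * y i) else x i * y i)

/-- The covariant derivative along `γ` induced on the quadric `⟪x,x⟫_t = 1/c`:
`∇X = X′ − c⟪X′,γ⟫_t γ`. -/
def cov (t : ℕ) {n : ℕ} (c : ℝ) (γ X : ℝ → Fin n → ℝ) : ℝ → Fin n → ℝ :=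
  fun s => deriv X s - (c * pform t (deriv X s) (γ s)) • γ s

/-- The curvature operator of the space form: `R(X,Y)Z = c(⟪Y,Z⟫_t X − ⟪X,Z⟫_t Y)`. -/
def curvOp (t : ℕ) {n : ℕ} (c : ℝ) (X Y Z : Fin n → ℝ) : Fin n → ℝ :=
  c • (pform t Y Z • X - pform t X Z • Y)

/-- The `r`-tension field of a curve `γ` in the space form:
`τ_r(γ) = ∇^{2r−1}T + ∑_{ℓ=0}^{r−2} (−1)^ℓ R(∇^{2r−3−ℓ}T, ∇^ℓT)T` with `T = γ′`. -/
def tensionField (t : ℕ) {n : ℕ} (c : ℝ) (r : ℕ) (γ : ℝ → Fin n → ℝ) (s : ℝ) : Fin n → ℝ :=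
  (cov t c γ)^[2*r-1] (deriv γ) s
    + ∑ ℓ ∈ Finset.range (r-1), ((-1 : ℝ)^ℓ) •
        curvOp t c ((cov t c γ)^[2*r-3-ℓ] (deriv γ) s) ((cov t c γ)^[ℓ] (deriv γ) s) (deriv γ s)

lemma pform_comm (t : ℕ) {n : ℕ} (x y : Fin n → ℝ) : pform t x y = pform t y x := by
  simp only [pform, mul_comm]

lemma pform_add_left (t : ℕ) {n : ℕ} (x y z : Fin n → ℝ) :
    pform t (x + y) z = pform t x z + pform t y z := by
  simp only [pform, ← Finset.sum_add_distrib, Pi.add_apply]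
  refine Finset.sum_congr rfl fun i _ => ?_
  split_ifs <;> ring

lemma pform_smul_left (t : ℕ) {n : ℕ} (a : ℝ) (x z : Fin n → ℝ) :
    pform t (a • x) z = a * pform t x z := by
  simp only [pform, Finset.mul_sum, Pi.smul_apply, smul_eq_mul]
  refine Finset.sum_congr rfl fun i _ => ?_
  split_ifs <;> ring

lemma pform_zero_left (t : ℕ) {n : ℕ} (z : Fin n → ℝ) : pform t 0 z = 0 := by
  simp [pform]

/-- On an open set the covariant derivative only depends on the values of the field there. -/
lemma cov_congr (t : ℕ) {n : ℕ} (c : ℝ) (γ : ℝ → Fin n → ℝ) {X Y : ℝ → Fin n → ℝ} {I : Set ℝ}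
    (hI : IsOpen I) (h : Set.EqOn X Y I) : Set.EqOn (cov t c γ X) (cov t c γ Y) I := by
  intro s hs
  simp only [cov, (h.eventuallyEq_of_mem (hI.mem_nhds hs)).deriv_eq]

lemma cov_linear_comb (t : ℕ) {n : ℕ} (c : ℝ) (γ : ℝ → Fin n → ℝ) {X Y : ℝ → Fin n → ℝ} {s : ℝ}
    (hX : DifferentiableAt ℝ X s) (hY : DifferentiableAt ℝ Y s) (p q : ℝ) :
    cov t c γ (fun u => p • X u + q • Y u) s = p • cov t c γ X s + q • cov t c γ Y s := by
  have h : deriv (fun u => p • X u + q • Y u) s = p • deriv X s + q • deriv Y s :=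
    ((hX.hasDerivAt.const_smul p).add (hY.hasDerivAt.const_smul q)).deriv
  simp only [cov, h, pform_add_left, pform_smul_left]
  module

lemma cov_const_smul (t : ℕ) {n : ℕ} (c : ℝ) (γ : ℝ → Fin n → ℝ) {X : ℝ → Fin n → ℝ} {s : ℝ}
    (hX : DifferentiableAt ℝ X s) (p : ℝ) :
    cov t c γ (fun u => p • X u) s = p • cov t c γ X s := by
  simpa using cov_linear_comb t c γ hX hX p 0

/-- If `∇T = b N`, `∇N = p T + q B` and `∇B = d N`, the iterated covariant derivatives of `T`
alternate between the direction of `N` and that of `p T + q B`. -/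
lemma cov_iterate_frenet (t : ℕ) {n : ℕ} (c : ℝ) (γ T N B : ℝ → Fin n → ℝ) {I : Set ℝ}
    (hI : IsOpen I) (hT : DifferentiableOn ℝ T I) (hN : DifferentiableOn ℝ N I)
    (hB : DifferentiableOn ℝ B I) {b p q d : ℝ}
    (h₁ : ∀ s ∈ I, cov t c γ T s = b • N s)
    (h₂ : ∀ s ∈ I, cov t c γ N s = p • T s + q • B s)
    (h₃ : ∀ s ∈ I, cov t c γ B s = d • N s) (k : ℕ) :
    (∀ s ∈ I, (cov t c γ)^[2 * k + 1] T s = ((p * b + q * d) ^ k * b) • N s) ∧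
    (∀ s ∈ I, (cov t c γ)^[2 * k + 2] T s =
      ((p * b + q * d) ^ k * b * p) • T s + ((p * b + q * d) ^ k * b * q) • B s) := by
  have even_of_odd : ∀ k : ℕ,
      (∀ s ∈ I, (cov t c γ)^[2 * k + 1] T s = ((p * b + q * d) ^ k * b) • N s) →
      (∀ s ∈ I, (cov t c γ)^[2 * k + 2] T s =
        ((p * b + q * d) ^ k * b * p) • T s + ((p * b + q * d) ^ k * b * q) • B s) := by
    intro k h s hs
    rw [Function.iterate_succ_apply', cov_congr t c γ hI h hs,
      cov_const_smul t c γ (hN.differentiableAt (hI.mem_nhds hs)), h₂ s hs]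
    module
  induction k with
  | zero =>
    have h : ∀ s ∈ I, (cov t c γ)^[2 * 0 + 1] T s = ((p * b + q * d) ^ 0 * b) • N s := by
      intro s hs
      simpa using h₁ s hs
    exact ⟨h, even_of_odd 0 h⟩
  | succ k ih =>
    have h : ∀ s ∈ I, (cov t c γ)^[2 * (k + 1) + 1] T s =
        ((p * b + q * d) ^ (k + 1) * b) • N s := by
      intro s hs
      rw [show 2 * (k + 1) + 1 = (2 * k + 2) + 1 by ring, Function.iterate_succ_apply',
        cov_congr t c γ hI ih.2 hs,
        cov_linear_comb t c γ (hT.differentiableAt (hI.mem_nhds hs))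
          (hB.differentiableAt (hI.mem_nhds hs)), h₁ s hs, h₃ s hs]
      module
    exact ⟨h, even_of_odd (k + 1) h⟩

/-- The bitension field, for a curve whose iterated covariant derivatives follow the
alternating pattern of `cov_iterate_frenet`. -/
lemma tensionField_two (t : ℕ) {n : ℕ} (c : ℝ) (γ : ℝ → Fin n → ℝ) (s : ℝ)
    (v : Fin n → ℝ) {a b e : ℝ}
    (hTT : pform t (deriv γ s) (deriv γ s) = e) (hvT : pform t v (deriv γ s) = 0)
    (hodd : ∀ k : ℕ, (cov t c γ)^[2 * k + 1] (deriv γ) s = (a ^ k * b) • v) :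
    tensionField t c 2 γ s = (b * (a + c * e)) • v := by
  have h₁ := hodd 0
  have h₃ := hodd 1
  norm_num at h₁ h₃
  simp only [tensionField, curvOp]
  norm_num
  rw [h₁, h₃, hTT, pform_smul_left, hvT]
  module

/-- The `r`-tension field for `r ≥ 3`, for a curve whose iterated covariant derivatives follow the
alternating pattern of `cov_iterate_frenet`. -/
lemma tensionField_add_three (t : ℕ) {n : ℕ} (c : ℝ) (γ : ℝ → Fin n → ℝ) (s : ℝ)
    (v w : Fin n → ℝ) {a b e f : ℝ}
    (hTT : pform t (deriv γ s) (deriv γ s) = e) (hvT : pform t v (deriv γ s) = 0)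
    (hwT : pform t w (deriv γ s) = f)
    (hodd : ∀ k : ℕ, (cov t c γ)^[2 * k + 1] (deriv γ) s = (a ^ k * b) • v)
    (heven : ∀ k : ℕ, (cov t c γ)^[2 * k + 2] (deriv γ) s = (a ^ k * b) • w) (r : ℕ) :
    tensionField t c (r + 3) γ s =
      (a ^ r * b * (a ^ 2 + c * e * a + ((r : ℝ) + 1) * (c * (b * f)))) • v := by
  have hterm : ∀ l ∈ Finset.range (r + 1), ((-1 : ℝ) ^ (l + 1)) •
      curvOp t c ((cov t c γ)^[2 * (r + 3) - 3 - (l + 1)] (deriv γ) s)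
        ((cov t c γ)^[l + 1] (deriv γ) s) (deriv γ s) = (a ^ r * b * (c * (b * f))) • v := by
    intro l hl
    have hl' : l < r + 1 := Finset.mem_range.mp hl
    rcases Nat.even_or_odd' l with ⟨j, rfl | rfl⟩
    · obtain ⟨i, rfl⟩ : ∃ i, r = j + i := ⟨r - j, by omega⟩
      rw [show 2 * (j + i + 3) - 3 - (2 * j + 1) = 2 * i + 2 by omega, hodd, heven]
      simp only [curvOp, pform_smul_left, hvT, hwT, pow_add, pow_mul]
      norm_num
      module
    · obtain ⟨i, rfl⟩ : ∃ i, r = j + i := ⟨r - j, by omega⟩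
      rw [show 2 * (j + i + 3) - 3 - (2 * j + 1 + 1) = 2 * i + 1 by omega,
        show 2 * j + 1 + 1 = 2 * j + 2 by ring, hodd, heven]
      simp only [curvOp, pform_smul_left, hvT, hwT, pow_add, pow_mul]
      norm_num
      module
  rw [tensionField, show r + 3 - 1 = r + 1 + 1 by omega, Finset.sum_range_succ',
    Finset.sum_congr rfl hterm, Finset.sum_const, Finset.card_range,
    show 2 * (r + 3) - 1 = 2 * (r + 2) + 1 by omega,
    show 2 * (r + 3) - 3 - 0 = 2 * (r + 1) + 1 by omega, hodd, hodd, ← Nat.cast_smul_eq_nsmul ℝ]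
  simp only [curvOp, Function.iterate_zero, id, hTT, pform_smul_left, hvT]
  push_cast
  module

/-- `r`-harmonicity conditions for a `3`-Frenet helix in the de Sitter space
form `S^m_t(c)` (`c > 0`, `m ≥ 3`): the biharmonic, triharmonic and `r ≥ 4` cases. -/
theorem stmt_6 (m t : ℕ) (hm : 3 ≤ m) (ht1 : 1 ≤ t) (ht2 : t ≤ m - 1)
    (c : ℝ) (hc : 0 < c)
    (I : Set ℝ) (hIopen : IsOpen I) (hIne : I.Nonempty)
    (γ N B : ℝ → Fin (m+1) → ℝ)
    (hγ : ContDiffOn ℝ (⊤ : ℕ∞) γ I) (hN : ContDiffOn ℝ (⊤ : ℕ∞) N I) (hB : ContDiffOn ℝ (⊤ : ℕ∞) B I)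
    (ε₁ ε₂ ε₃ : ℝ) (hε₁ : ε₁ = 1 ∨ ε₁ = -1) (hε₂ : ε₂ = 1 ∨ ε₂ = -1) (hε₃ : ε₃ = 1 ∨ ε₃ = -1)
    (κ τ : ℝ) (hκ : 0 < κ) (hτ : 0 < τ)
    (hquad : ∀ s ∈ I, pform t (γ s) (γ s) = 1 / c)
    (hTT : ∀ s ∈ I, pform t (deriv γ s) (deriv γ s) = ε₁)
    (hNN : ∀ s ∈ I, pform t (N s) (N s) = ε₂)
    (hBB : ∀ s ∈ I, pform t (B s) (B s) = ε₃)
    (hTN : ∀ s ∈ I, pform t (deriv γ s) (N s) = 0)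
    (hTB : ∀ s ∈ I, pform t (deriv γ s) (B s) = 0)
    (hNB : ∀ s ∈ I, pform t (N s) (B s) = 0)
    (hNtan : ∀ s ∈ I, pform t (N s) (γ s) = 0)
    (hBtan : ∀ s ∈ I, pform t (B s) (γ s) = 0)
    (hFr1 : ∀ s ∈ I, cov t c γ (deriv γ) s = (ε₂ * κ) • N s)
    (hFr2 : ∀ s ∈ I, cov t c γ N s = (-(ε₁ * κ)) • deriv γ s + (ε₃ * τ) • B s)
    (hFr3 : ∀ s ∈ I, cov t c γ B s = (-(ε₂ * τ)) • N s) :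
    ((∀ s ∈ I, tensionField t c 2 γ s = 0) ↔
        ε₂ * (ε₁ * κ ^ 2 + ε₃ * τ ^ 2) = c * ε₁) ∧
    ((∀ s ∈ I, tensionField t c 3 γ s = 0) ↔
        ε₂ * (ε₁ * κ ^ 2 + ε₃ * τ ^ 2) ^ 2 = c * (ε₁ * ε₃ * τ ^ 2 + 2 * κ ^ 2)) ∧
    (∀ r : ℕ, 4 ≤ r →
      ((∀ s ∈ I, tensionField t c r γ s = 0) ↔
        (ε₁ * κ ^ 2 + ε₃ * τ ^ 2) ^ (r - 3) *
          (ε₂ * (ε₁ * κ ^ 2 + ε₃ * τ ^ 2) ^ 2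
            - c * (ε₁ * ε₃ * τ ^ 2 + ((r : ℝ) - 1) * κ ^ 2)) = 0)) := by
  have hγ' : DifferentiableOn ℝ (deriv γ) I :=
    (hγ.deriv_of_isOpen (m := 1) hIopen (WithTop.coe_le_coe.mpr le_top)).differentiableOn (by simp)
  have hN' : DifferentiableOn ℝ N I := hN.differentiableOn (by simp)
  have hB' : DifferentiableOn ℝ B I := hB.differentiableOn (by simp)
  have h₁ : ε₁ ^ 2 = 1 := by rcases hε₁ with h | h <;> norm_num [h]
  have h₂ : ε₂ ^ 2 = 1 := by rcases hε₂ with h | h <;> norm_num [h]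
  have hb : ε₂ * κ ≠ 0 := mul_ne_zero (by rintro rfl; norm_num at h₂) hκ.ne'
  have hε₂0 : ε₂ ≠ 0 := left_ne_zero_of_mul hb
  have hN0 : ∀ s ∈ I, N s ≠ 0 := by
    intro s hs h
    have := hNN s hs
    rw [h, pform_zero_left] at this
    exact hε₂0 this.symm
  have hit := cov_iterate_frenet t c γ (deriv γ) N B hIopen hγ' hN' hB' hFr1 hFr2 hFr3
  have ha : -(ε₁ * κ) * (ε₂ * κ) + ε₃ * τ * -(ε₂ * τ) = -ε₂ * (ε₁ * κ ^ 2 + ε₃ * τ ^ 2) := by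
    ring
  rw [ha] at hit
  have hodd := fun k => (hit k).1
  have heven : ∀ (k : ℕ), ∀ s ∈ I, (cov t c γ)^[2 * k + 2] (deriv γ) s =
      ((-ε₂ * (ε₁ * κ ^ 2 + ε₃ * τ ^ 2)) ^ k * (ε₂ * κ)) •
        ((-(ε₁ * κ)) • deriv γ s + (ε₃ * τ) • B s) := by
    intro k s hs
    rw [(hit k).2 s hs]
    module
  have hwT : ∀ s ∈ I, pform t ((-(ε₁ * κ)) • deriv γ s + (ε₃ * τ) • B s) (deriv γ s) = -κ := by
    intro s hs
    rw [pform_add_left, pform_smul_left, pform_smul_left, hTT s hs, pform_comm t (B s), hTB s hs]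
    linear_combination (-κ) * h₁
  have hvT : ∀ s ∈ I, pform t (N s) (deriv γ s) = 0 := fun s hs => by
    rw [pform_comm, hTN s hs]
  have vanish_iff : ∀ (F : ℝ → Fin (m + 1) → ℝ) (x : ℝ), (∀ s ∈ I, F s = x • N s) →
      ((∀ s ∈ I, F s = 0) ↔ x = 0) := by
    intro F x hF
    constructor
    · intro h
      obtain ⟨s, hs⟩ := hIne
      have := h s hs
      rw [hF s hs] at this
      exact (smul_eq_zero.mp this).resolve_right (hN0 s hs)
    · intro h s hs
      rw [hF s hs, h, zero_smul]
  have key : ∀ r : ℕ, (∀ s ∈ I, tensionField t c (r + 3) γ s = 0) ↔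
      (ε₁ * κ ^ 2 + ε₃ * τ ^ 2) ^ r *
          (ε₂ * (ε₁ * κ ^ 2 + ε₃ * τ ^ 2) ^ 2
            - c * (ε₁ * ε₃ * τ ^ 2 + ((r : ℝ) + 2) * κ ^ 2)) = 0 := by
    intro r
    rw [vanish_iff _ _ fun s hs => tensionField_add_three t c γ s (N s) _ (hTT s hs) (hvT s hs)
      (hwT s hs) (fun k => hodd k s hs) (fun k => heven k s hs) r]
    set A := ε₁ * κ ^ 2 + ε₃ * τ ^ 2 with hA
    have hbr : (-ε₂ * A) ^ 2 + c * ε₁ * (-ε₂ * A) + ((r : ℝ) + 1) * (c * (ε₂ * κ * -κ)) =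
        ε₂ * (ε₂ * A ^ 2 - c * (ε₁ * ε₃ * τ ^ 2 + ((r : ℝ) + 2) * κ ^ 2)) := by
      linear_combination (-c * ε₂ * ε₁) * hA - (c * ε₂ * κ ^ 2) * h₁
    rw [hbr, mul_pow]
    have hpow : (-ε₂) ^ r ≠ 0 := pow_ne_zero r (neg_ne_zero.mpr hε₂0)
    simp only [mul_eq_zero, hpow, hε₂0, hκ.ne', false_or, or_false]
  refine ⟨?_, ?_, ?_⟩
  · rw [vanish_iff _ _ fun s hs => tensionField_two t c γ s (N s) (hTT s hs) (hvT s hs)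
      fun k => hodd k s hs, mul_eq_zero, or_iff_right hb]
    constructor <;> intro h <;> linear_combination -h
  · rw [key 0, pow_zero, one_mul, sub_eq_zero]
    norm_num
  · intro r hr
    obtain ⟨k, rfl⟩ : ∃ k, r = k + 3 := ⟨r - 3, by omega⟩
    rw [key k, Nat.add_sub_cancel]
    push_cast
    rw [show (k : ℝ) + 3 - 1 = k + 2 by ring]
end
end

section
/- There exist an open interval I ⊂ ℝ, a smooth nonconstant function k : I → ℝ with k > 0 on I, and a smooth function τ : I → ℝ with τ > 0 on I, such that on I: (1) k‴k + 2k³k′ + 2k′k″ = 0, and (2) −(k″ + 2k³)τ² + k⁗ + 10k²k″ + 15k(k′)² + k⁵ = 0. Moreover k and τ can be chosen so that additionally 5(k′)² + k⁴ = 1 and τ² = 63(1 − 2k⁴)/(40k²) on I. (Equations (1) and (2) are, with ε₁ = −1 and ε₂ = 1, the vanishing of the tangential and normal components of the tritension field of the base curve γ(s) = X(s,0) of the ruled Lorentzian surface S_γ ⊂ ℝ³₁, whose Gaussian curvature along γ equals τ²; this is the analytic content of the theorem asserting the existence of a proper triharmonic curve with nonconstant curvature in a ruled Lorentzian surface.)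 -/
/-- A solution of an autonomous ODE with smooth right-hand side is smooth. -/
theorem contDiffOn_of_hasDerivAt_comp {E : Type*} [NormedAddCommGroup E] [NormedSpace ℝ E]
    {f : E → E} {α : ℝ → E} {s : Set ℝ} {u : Set E} (hs : IsOpen s)
    (hf : ContDiffOn ℝ (⊤ : ℕ∞) f u) (hα : ∀ t ∈ s, HasDerivAt α (f (α t)) t)
    (hu : Set.MapsTo α s u) : ContDiffOn ℝ (⊤ : ℕ∞) α s := by
  rw [contDiffOn_infty]
  intro n
  induction n with
  | zero => exact contDiffOn_zero.2 fun t ht ↦ (hα t ht).continuousAt.continuousWithinAt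
  | succ n ih =>
    rw [Nat.cast_succ, contDiffOn_succ_iff_deriv_of_isOpen hs]
    refine ⟨fun t ht ↦ (hα t ht).differentiableAt.differentiableWithinAt, by simp, ?_⟩
    exact ((contDiffOn_infty.1 hf n).comp ih hu).congr fun t ht ↦ (hα t ht).deriv

/-- If the `n`-th derivative of `f` agrees with `g` on an open set, the next one is computed by
differentiating `g`. -/
theorem iteratedDeriv_succ_eq_of_hasDerivAt {f g g' : ℝ → ℝ} {s : Set ℝ} {n : ℕ} (hs : IsOpen s)
    (h : ∀ t ∈ s, iteratedDeriv n f t = g t) (hg : ∀ t ∈ s, HasDerivAt g (g' t) t) :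
    ∀ t ∈ s, iteratedDeriv (n + 1) f t = g' t := by
  intro t ht
  rw [iteratedDeriv_succ]
  exact ((hg t ht).congr_of_eventuallyEq (Filter.eventually_of_mem (hs.mem_nhds ht) h)).deriv

/-- The vector field `y ↦ √((1 - y⁴) / 5)` is smooth on `(1/4, 3/4)`. -/
theorem contDiffOn_sqrt_one_sub_pow_four_div_five :
    ContDiffOn ℝ (⊤ : ℕ∞) (fun y : ℝ ↦ √((1 - y ^ 4) / 5)) (Set.Ioo (1 / 4) (3 / 4)) := by
  refine ContDiffOn.sqrt (by fun_prop) fun y hy ↦ ?_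
  have : y ^ 4 < (3 / 4) ^ 4 := pow_lt_pow_left₀ hy.2 (by linarith [hy.1]) (by norm_num)
  norm_num at this
  exact ne_of_gt (by linarith)

/-- The equation `k' = √((1 - k⁴) / 5)` has a local solution with values in `(1/4, 3/4)`. -/
theorem exists_hasDerivAt_sqrt_one_sub_pow_four_div_five :
    ∃ (k : ℝ → ℝ) (a b : ℝ), a < b ∧
      (∀ t ∈ Set.Ioo a b, HasDerivAt k (√((1 - k t ^ 4) / 5)) t) ∧
      Set.MapsTo k (Set.Ioo a b) (Set.Ioo (1 / 4) (3 / 4)) := by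
  have hmem : Set.Ioo (1 / 4 : ℝ) (3 / 4) ∈ nhds (1 / 2 : ℝ) :=
    Ioo_mem_nhds (by norm_num) (by norm_num)
  have hv := (contDiffOn_sqrt_one_sub_pow_four_div_five.contDiffAt hmem).of_le
    (m := 1) (by exact_mod_cast le_top)
  obtain ⟨k, hk0, ε, hε, hk⟩ :=
    hv.exists_forall_mem_closedBall_exists_eq_forall_mem_Ioo_hasDerivAt₀ 0
  have hcont : ContinuousAt k 0 := (hk 0 ⟨by linarith, by linarith⟩).continuousAt
  obtain ⟨δ, hδ, hball⟩ := Metric.mem_nhds_iff.1 (hcont.preimage_mem_nhds (by rwa [hk0]))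
  rw [Real.ball_eq_Ioo] at hball
  refine ⟨k, 0 - min δ ε, 0 + min δ ε, ?_, fun t ht ↦ hk t ⟨?_, ?_⟩, fun t ht ↦ hball ⟨?_, ?_⟩⟩
  · have := lt_min hδ hε
    linarith
  all_goals linarith [ht.1, ht.2, min_le_left δ ε, min_le_right δ ε]

/-- There exist a smooth positive nonconstant curvature function `k` and a
smooth positive function `τ` on an open interval solving the triharmonicity system of the
base curve of a ruled Lorentzian surface in `ℝ³₁` (with `ε₁ = −1`, `ε₂ = 1`), together with
the first integrals `5(k′)² + k⁴ = 1` and `τ² = 63(1 − 2k⁴)/(40k²)`. -/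
theorem stmt_16 :
    ∃ (a b : ℝ) (k τ : ℝ → ℝ), a < b ∧
      ContDiffOn ℝ (⊤ : ℕ∞) k (Set.Ioo a b) ∧ ContDiffOn ℝ (⊤ : ℕ∞) τ (Set.Ioo a b) ∧
      (∃ s₁ ∈ Set.Ioo a b, ∃ s₂ ∈ Set.Ioo a b, k s₁ ≠ k s₂) ∧
      (∀ s ∈ Set.Ioo a b, 0 < k s) ∧
      (∀ s ∈ Set.Ioo a b, 0 < τ s) ∧
      (∀ s ∈ Set.Ioo a b,
        iteratedDeriv 3 k s * k s + 2 * (k s) ^ 3 * deriv k s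
          + 2 * deriv k s * iteratedDeriv 2 k s = 0) ∧
      (∀ s ∈ Set.Ioo a b,
        -(iteratedDeriv 2 k s + 2 * (k s) ^ 3) * (τ s) ^ 2 + iteratedDeriv 4 k s
          + 10 * (k s) ^ 2 * iteratedDeriv 2 k s + 15 * k s * (deriv k s) ^ 2
          + (k s) ^ 5 = 0) ∧
      (∀ s ∈ Set.Ioo a b, 5 * (deriv k s) ^ 2 + (k s) ^ 4 = 1) ∧
      (∀ s ∈ Set.Ioo a b, (τ s) ^ 2 = 63 * (1 - 2 * (k s) ^ 4) / (40 * (k s) ^ 2)) := by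
  obtain ⟨k, a, b, hab, hk, hmaps⟩ := exists_hasDerivAt_sqrt_one_sub_pow_four_div_five
  have hsmooth := contDiffOn_of_hasDerivAt_comp isOpen_Ioo
    contDiffOn_sqrt_one_sub_pow_four_div_five hk hmaps
  have hpos : ∀ s ∈ Set.Ioo a b, 0 < k s := fun s hs ↦ by linarith [(hmaps hs).1]
  have hlt : ∀ s ∈ Set.Ioo a b, 2 * k s ^ 4 < 1 := fun s hs ↦ by
    have : k s ^ 4 < (3 / 4) ^ 4 := pow_lt_pow_left₀ (hmaps hs).2 (hpos s hs).le (by norm_num)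
    norm_num at this
    linarith
  have hrad : ∀ s ∈ Set.Ioo a b, 0 < (1 - k s ^ 4) / 5 := fun s hs ↦ by
    linarith [hlt s hs, pow_pos (hpos s hs) 4]
  have hd : ∀ s ∈ Set.Ioo a b, HasDerivAt k (deriv k s) s := fun s hs ↦
    (hk s hs).differentiableAt.hasDerivAt
  have hdpos : ∀ s ∈ Set.Ioo a b, 0 < deriv k s := fun s hs ↦
    (hk s hs).deriv ▸ Real.sqrt_pos.2 (hrad s hs)
  have hfirst : ∀ s ∈ Set.Ioo a b, 5 * deriv k s ^ 2 + k s ^ 4 = 1 := fun s hs ↦ by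
    rw [(hk s hs).deriv, Real.sq_sqrt (hrad s hs).le]
    ring
  have h1 : ∀ s ∈ Set.Ioo a b, iteratedDeriv 1 k s = √((1 - k s ^ 4) / 5) := fun s hs ↦ by
    rw [iteratedDeriv_one, (hk s hs).deriv]
  have h2 : ∀ s ∈ Set.Ioo a b, iteratedDeriv 2 k s = -(2 / 5) * k s ^ 3 := by
    refine iteratedDeriv_succ_eq_of_hasDerivAt isOpen_Ioo h1 fun s hs ↦ ?_
    have hne := (Real.sqrt_pos.2 (hrad s hs)).ne'
    convert ((((hk s hs).fun_pow 4).const_sub 1).div_const 5).sqrt (hrad s hs).ne' using 1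
    field_simp
    norm_num
  have h3 : ∀ s ∈ Set.Ioo a b, iteratedDeriv 3 k s = -(6 / 5) * (k s ^ 2 * deriv k s) := by
    refine iteratedDeriv_succ_eq_of_hasDerivAt isOpen_Ioo h2 fun s hs ↦ ?_
    refine (((hd s hs).fun_pow 3).const_mul (-(2 / 5))).congr_deriv ?_
    norm_num
    ring
  have hd2 : ∀ s ∈ Set.Ioo a b, HasDerivAt (deriv k) (-(2 / 5) * k s ^ 3) s := fun s hs ↦ by
    rw [← h2 s hs, iteratedDeriv_succ, iteratedDeriv_one]
    have h : ContDiffOn ℝ (⊤ : ℕ∞) (deriv k) (Set.Ioo a b) :=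
      ((contDiffOn_infty_iff_deriv_of_isOpen isOpen_Ioo).1 hsmooth).2
    exact ((h.contDiffAt (isOpen_Ioo.mem_nhds hs)).differentiableAt (by simp)).hasDerivAt
  have h4 : ∀ s ∈ Set.Ioo a b, iteratedDeriv 4 k s =
      -(12 / 5) * k s * deriv k s ^ 2 + 12 / 25 * k s ^ 5 := by
    refine iteratedDeriv_succ_eq_of_hasDerivAt isOpen_Ioo h3 fun s hs ↦ ?_
    refine ((((hd s hs).fun_pow 2).fun_mul (hd2 s hs)).const_mul (-(6 / 5))).congr_deriv ?_
    norm_num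
    ring
  have hτ : ∀ s ∈ Set.Ioo a b, 0 < 63 * (1 - 2 * k s ^ 4) / (40 * k s ^ 2) := fun s hs ↦
    div_pos (by linarith [hlt s hs]) (by linarith [pow_pos (hpos s hs) 2])
  refine ⟨a, b, k, fun s ↦ √(63 * (1 - 2 * k s ^ 4) / (40 * k s ^ 2)), hab, hsmooth, ?_, ?_,
    hpos, fun s hs ↦ Real.sqrt_pos.2 (hτ s hs), fun s hs ↦ ?_, fun s hs ↦ ?_, hfirst,
    fun s hs ↦ Real.sq_sqrt (hτ s hs).le⟩
  · refine ContDiffOn.sqrt (ContDiffOn.div (by fun_prop) (by fun_prop) fun s hs ↦ ?_)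
      fun s hs ↦ (hτ s hs).ne'
    have := hpos s hs
    positivity
  · obtain ⟨c, hac, hcb⟩ := exists_between hab
    obtain ⟨d, hcd, hdb⟩ := exists_between hcb
    have hmono : StrictMonoOn k (Set.Ioo a b) :=
      strictMonoOn_of_deriv_pos (convex_Ioo a b) hsmooth.continuousOn
        (by rwa [interior_Ioo])
    have hc : c ∈ Set.Ioo a b := ⟨hac, hcb⟩
    have hd' : d ∈ Set.Ioo a b := ⟨hac.trans hcd, hdb⟩
    exact ⟨c, hc, d, hd', (hmono hc hd' hcd).ne⟩
  · rw [h3 s hs, h2 s hs]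
    ring
  · have hne := (hpos s hs).ne'
    have hsq : deriv k s ^ 2 = (1 - k s ^ 4) / 5 := by linarith [hfirst s hs]
    rw [Real.sq_sqrt (hτ s hs).le, h4 s hs, h2 s hs, hsq]
    field_simp
    ring
end
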